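/- arXiv:2302.01446 — 3 statements merged into one kernel-verified Lean document; each statement's English description precedes it below -/
import Mathlib

section
/- Let 1 < a < b and set C = 1 + a + a² + (a−1)b + b². Define Q₁ : ℝ → ℝ by Q₁(θ) = (4(a+1)(a+b) − C − 4(a+1)(a+b) cos(2θ) + C cos(4θ)) / (8(a+1)(b−1)(a+b)). Then the minimum value of Q₁ over ℝ is −(b−1)³ / (4(a+1)(a+b)(1 + a + a² + (a−1)b + b²)); that is, this value is attained by Q₁ at some θ and Q₁(θ) is at least this value for all θ. Moreover Q₁(0) = 0 and Q₁(π/2) = 1/(b−1) > 0. -/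
open Real

/-- The quadratic Taylor coefficient `Q₁(θ)` of the linear distortion along the rank-one family
with `r = s = 1`, `θ₂ = π − θ₁`: its minimum over `ℝ` is
`−(b−1)³ / (4(a+1)(a+b)(1 + a + a² + (a−1)b + b²))`, it vanishes at `θ = 0`, and equals
`1/(b−1) > 0` at `θ = π/2`. -/
theorem Q1_min_value (a b : ℝ) (ha : 1 < a) (hab : a < b)
    (C : ℝ) (hC : C = 1 + a + a ^ 2 + (a - 1) * b + b ^ 2)
    (Q₁ : ℝ → ℝ)
    (hQ : ∀ θ : ℝ, Q₁ θ =
      (4 * (a + 1) * (a + b) - C - 4 * (a + 1) * (a + b) * Real.cos (2 * θ)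
        + C * Real.cos (4 * θ)) / (8 * (a + 1) * (b - 1) * (a + b))) :
    (∃ θ : ℝ, Q₁ θ =
        -(b - 1) ^ 3 / (4 * (a + 1) * (a + b) * (1 + a + a ^ 2 + (a - 1) * b + b ^ 2))) ∧
    (∀ θ : ℝ,
        -(b - 1) ^ 3 / (4 * (a + 1) * (a + b) * (1 + a + a ^ 2 + (a - 1) * b + b ^ 2)) ≤ Q₁ θ) ∧
    Q₁ 0 = 0 ∧ Q₁ (Real.pi / 2) = 1 / (b - 1) ∧ 0 < 1 / (b - 1) := by
  have hb : 0 < b - 1 := by linarith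
  have h1 : 0 < a + 1 := by linarith
  have h2 : 0 < a + b := by linarith
  have hCp : C = (a + 1) * (a + b) + (b - 1) ^ 2 := by rw [hC]; ring
  have hP : 0 < (a + 1) * (a + b) := mul_pos h1 h2
  have hC0 : 0 < C := by rw [hCp]; positivity
  have key : ∀ θ : ℝ, Q₁ θ =
      -(b - 1) ^ 3 / (4 * (a + 1) * (a + b) * C)
        + (C * Real.cos (2 * θ) - (a + 1) * (a + b)) ^ 2
          / (4 * ((a + 1) * (a + b)) * (b - 1) * C) := by
    intro θ
    have h4 : Real.cos (4 * θ) = 2 * Real.cos (2 * θ) ^ 2 - 1 := by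
      rw [← Real.cos_two_mul]; congr 1; ring
    rw [hQ, h4]
    generalize Real.cos (2 * θ) = x
    have e : (b - 1) ^ 4 = (C - (a + 1) * (a + b)) ^ 2 := by rw [hCp]; ring
    have hne : b - 1 ≠ 0 := hb.ne'
    have e1 : -(b - 1) ^ 3 / (4 * (a + 1) * (a + b) * C)
        = -(C - (a + 1) * (a + b)) ^ 2 / (4 * ((a + 1) * (a + b)) * (b - 1) * C) := by
      rw [← e]; field_simp
    rw [e1, ← add_div, div_eq_div_iff (by positivity) (by positivity)]
    ring
  rw [← hC]
  refine ⟨⟨Real.arccos ((a + 1) * (a + b) / C) / 2, ?_⟩, ?_, ?_, ?_, ?_⟩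
  · have hle : (a + 1) * (a + b) / C ≤ 1 := by
      rw [div_le_one hC0, hCp]; nlinarith [sq_nonneg (b - 1)]
    have hge : -1 ≤ (a + 1) * (a + b) / C := by
      have : 0 ≤ (a + 1) * (a + b) / C := by positivity
      linarith
    rw [key, mul_div_cancel₀ _ (two_ne_zero), Real.cos_arccos hge hle,
      mul_div_cancel₀ _ hC0.ne']
    simp
  · intro θ
    rw [key]
    have : 0 ≤ (C * Real.cos (2 * θ) - (a + 1) * (a + b)) ^ 2
          / (4 * ((a + 1) * (a + b)) * (b - 1) * C) := by positivity
    linarith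
  · rw [hQ]; simp
  · rw [hQ, show 2 * (Real.pi / 2) = Real.pi by ring,
      show 4 * (Real.pi / 2) = 2 * Real.pi by ring, Real.cos_pi, Real.cos_two_pi,
      div_eq_div_iff (by positivity) hb.ne']
    ring
  · positivity
end

section
/- Let 1 < a < b and let P(t) = c₂ t² + c₁ t + c₀ with c₂ = −1 − a − 2a² − 4b − 7ab − 4a²b + 2b² − 7ab² − 2a²b² − 4b³ − ab³ − b⁴, c₁ = −1 + 2a + a² + 4a³ − 6b − 4ab + 7a²b + 8a³b − b² − 12ab² + 7a²b² + 4a³b² − b³ − 4ab³ + a²b³ − 6b⁴ + 2ab⁴ − b⁵, c₀ = −2(−a + a⁴ + b − ab − 2a²b + 2a⁴b + b² + 2ab² − 4a²b² + a⁴b² + 2ab³ − 2a²b³ + b⁴ − ab⁴ + b⁵ − ab⁵). Let G₁ = −c₁ and J₁ = 1 + 4a + 10a² + 12a³ + 9a⁴ + 4b + 16ab + 22a²b + 20a³b − 2a⁴b + 12ab² + 32a²b² + 20a³b² + 9a⁴b² + 6b³ + 12ab³ + 22a²b³ + 12a³b³ + 16ab⁴ + 10a²b⁴ + 4b⁵ +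 4ab⁵ + b⁶, and define t₊ = (G₁ − (b²−1)√J₁)/(2c₂) and t₋ = (G₁ + (b²−1)√J₁)/(2c₂). Then J₁ > 0, P(t₊) = 0, P(t₋) = 0, t₋ < 0 < t₊, and every real root of P equals t₊ or t₋. -/
/-- The explicit quadratic factor `P(t)` of the discriminant has exactly the two real roots
`t₊ > 0 > t₋` given by the quadratic formula with discriminant data `G₁` and `J₁`. -/
theorem quadratic_factor_roots (a b : ℝ) (ha : 1 < a) (hab : a < b)
    (c₂ c₁ c₀ G₁ J₁ tP tM : ℝ) (P : ℝ → ℝ)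
    (hc₂ : c₂ = -1 - a - 2 * a ^ 2 - 4 * b - 7 * a * b - 4 * a ^ 2 * b + 2 * b ^ 2
      - 7 * a * b ^ 2 - 2 * a ^ 2 * b ^ 2 - 4 * b ^ 3 - a * b ^ 3 - b ^ 4)
    (hc₁ : c₁ = -1 + 2 * a + a ^ 2 + 4 * a ^ 3 - 6 * b - 4 * a * b + 7 * a ^ 2 * b
      + 8 * a ^ 3 * b - b ^ 2 - 12 * a * b ^ 2 + 7 * a ^ 2 * b ^ 2 + 4 * a ^ 3 * b ^ 2
      - b ^ 3 - 4 * a * b ^ 3 + a ^ 2 * b ^ 3 - 6 * b ^ 4 + 2 * a * b ^ 4 - b ^ 5)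
    (hc₀ : c₀ = -2 * (-a + a ^ 4 + b - a * b - 2 * a ^ 2 * b + 2 * a ^ 4 * b + b ^ 2
      + 2 * a * b ^ 2 - 4 * a ^ 2 * b ^ 2 + a ^ 4 * b ^ 2 + 2 * a * b ^ 3 - 2 * a ^ 2 * b ^ 3
      + b ^ 4 - a * b ^ 4 + b ^ 5 - a * b ^ 5))
    (hP : ∀ t : ℝ, P t = c₂ * t ^ 2 + c₁ * t + c₀)
    (hG₁ : G₁ = -c₁)
    (hJ₁ : J₁ = 1 + 4 * a + 10 * a ^ 2 + 12 * a ^ 3 + 9 * a ^ 4 + 4 * b + 16 * a * b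
      + 22 * a ^ 2 * b + 20 * a ^ 3 * b - 2 * a ^ 4 * b + 12 * a * b ^ 2 + 32 * a ^ 2 * b ^ 2
      + 20 * a ^ 3 * b ^ 2 + 9 * a ^ 4 * b ^ 2 + 6 * b ^ 3 + 12 * a * b ^ 3 + 22 * a ^ 2 * b ^ 3
      + 12 * a ^ 3 * b ^ 3 + 16 * a * b ^ 4 + 10 * a ^ 2 * b ^ 4 + 4 * b ^ 5 + 4 * a * b ^ 5
      + b ^ 6)
    (htP : tP = (G₁ - (b ^ 2 - 1) * Real.sqrt J₁) / (2 * c₂))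
    (htM : tM = (G₁ + (b ^ 2 - 1) * Real.sqrt J₁) / (2 * c₂)) :
    0 < J₁ ∧ P tP = 0 ∧ P tM = 0 ∧ tM < 0 ∧ 0 < tP ∧
      ∀ t : ℝ, P t = 0 → t = tP ∨ t = tM := by
  have hb : 1 < b := ha.trans hab
  have ha0 : 0 < a := by linarith
  have hb0 : 0 < b := by linarith
  have hbb : 0 < b ^ 2 - 1 := by nlinarith
  have hJ : 0 < J₁ := by
    have h1 : 0 < 9 * a ^ 4 * b ^ 2 - 2 * a ^ 4 * b := by
      have : 9 * a ^ 4 * b ^ 2 - 2 * a ^ 4 * b = a ^ 4 * b * (9 * b - 2) := by ring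
      rw [this]
      have : 0 < 9 * b - 2 := by linarith
      positivity
    have h2 : J₁ = (9 * a ^ 4 * b ^ 2 - 2 * a ^ 4 * b) + (1 + 4 * a + 10 * a ^ 2 + 12 * a ^ 3
      + 9 * a ^ 4 + 4 * b + 16 * a * b
      + 22 * a ^ 2 * b + 20 * a ^ 3 * b + 12 * a * b ^ 2 + 32 * a ^ 2 * b ^ 2
      + 20 * a ^ 3 * b ^ 2 + 6 * b ^ 3 + 12 * a * b ^ 3 + 22 * a ^ 2 * b ^ 3
      + 12 * a ^ 3 * b ^ 3 + 16 * a * b ^ 4 + 10 * a ^ 2 * b ^ 4 + 4 * b ^ 5 + 4 * a * b ^ 5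
      + b ^ 6) := by rw [hJ₁]; ring
    rw [h2]
    positivity
  have hc2 : c₂ < 0 := by
    have h2 : c₂ = -(1 + a + 2 * a ^ 2 + 4 * b + 7 * a * b + 4 * a ^ 2 * b + 7 * a * b ^ 2
      + 2 * a ^ 2 * b ^ 2 + 2 * b ^ 3 + a * b ^ 3 + b ^ 4 + 2 * b ^ 2 * (b - 1)) := by
      rw [hc₂]; ring
    have h3 : 0 < b - 1 := by linarith
    have h4 : 0 < 1 + a + 2 * a ^ 2 + 4 * b + 7 * a * b + 4 * a ^ 2 * b + 7 * a * b ^ 2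
      + 2 * a ^ 2 * b ^ 2 + 2 * b ^ 3 + a * b ^ 3 + b ^ 4 + 2 * b ^ 2 * (b - 1) := by positivity
    linarith
  have hc0 : 0 < c₀ := by
    have h : c₀ = 2 * (1 + b) ^ 2 * (a - 1) * (b - a)
        * (a ^ 2 + (1 + b) * a + 1 + b * (b - 1)) := by
      rw [hc₀]; ring
    have h1 : 0 < a - 1 := by linarith
    have h2 : 0 < b - a := by linarith
    have h3 : 0 < b - 1 := by linarith
    rw [h]; positivity
  have hdisc : c₁ ^ 2 - 4 * c₂ * c₀ = (b ^ 2 - 1) ^ 2 * J₁ := by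
    rw [hc₁, hc₂, hc₀, hJ₁]; ring
  clear hc₁ hc₂ hc₀ hJ₁
  have hs : Real.sqrt J₁ ^ 2 = J₁ := Real.sq_sqrt hJ.le
  have hs0 : 0 < Real.sqrt J₁ := Real.sqrt_pos.mpr hJ
  obtain ⟨S, hS⟩ : ∃ S, S = (b ^ 2 - 1) * Real.sqrt J₁ := ⟨_, rfl⟩
  have hS0 : 0 < S := by rw [hS]; positivity
  have hS2 : S ^ 2 = c₁ ^ 2 - 4 * c₂ * c₀ := by rw [hdisc, hS, mul_pow, hs]
  rw [← hS, hG₁] at htP htM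
  have hprod : 0 < -c₂ * c₀ := mul_pos (by linarith) hc0
  have hlt : |c₁| < S := abs_lt_of_sq_lt_sq (by nlinarith) hS0.le
  obtain ⟨hl, hr⟩ := abs_lt.mp hlt
  have hne : 2 * c₂ ≠ 0 := (by linarith : 2 * c₂ < 0).ne
  have hp : 2 * c₂ * tP = -c₁ - S := by rw [htP]; exact mul_div_cancel₀ _ hne
  have hm : 2 * c₂ * tM = -c₁ + S := by rw [htM]; exact mul_div_cancel₀ _ hne
  have hfac : ∀ t, 4 * c₂ * P t = (2 * c₂ * t - 2 * c₂ * tP) * (2 * c₂ * t - 2 * c₂ * tM) := by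
    intro t
    rw [hp, hm, hP]
    linear_combination hS2
  have h4 : 4 * c₂ ≠ 0 := (by linarith : 4 * c₂ < 0).ne
  refine ⟨hJ, ?_, ?_, ?_, ?_, ?_⟩
  · have := hfac tP
    rw [sub_self, zero_mul] at this
    exact (mul_eq_zero.mp this).resolve_left h4
  · have := hfac tM
    rw [sub_self, mul_zero] at this
    exact (mul_eq_zero.mp this).resolve_left h4
  · rw [htM]; exact div_neg_of_pos_of_neg (by linarith) (by linarith)
  · rw [htP]; exact div_pos_of_neg_of_neg (by linarith) (by linarith)
  · intro t ht
    have := hfac t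
    rw [ht, mul_zero] at this
    rcases mul_eq_zero.mp this.symm with h | h
    · left; exact mul_left_cancel₀ hne (sub_eq_zero.mp h)
    · right; exact mul_left_cancel₀ hne (sub_eq_zero.mp h)
end

section
/- Let 1 < a < b, A = diag(1, a, b), D = 1 + a + a² + (a−1)b + b², u₁ = (b−1)/√(2(b+1)D), u₂ = √((1 + 2a² + b² + 2a(1+b))/(2D)), u₃ = (b−1)√b/√(2(b+1)D), u = (u₁, u₂, u₃), v = (u₁, −u₂, u₃), B₀ = u vᵀ, and let t₊ > 0 > t₋ be as follows: with c₂ = −1 − a − 2a² − 4b − 7ab − 4a²b + 2b² − 7ab² − 2a²b² − 4b³ − ab³ − b⁴, G₁ = 1 − 2a − a² − 4a³ + 6b + 4ab − 7a²b − 8a³b + b² + 12ab² − 7a²b² − 4a³b² + b³ + 4ab³ − a²b³ + 6b⁴ − 2ab⁴ + b⁵, J₁ = 1 + 4a + 10a² + 12a³ + 9a⁴ + 4b + 16ab + 22a²b + 20a³b − 2a⁴b + 12ab² + 32a²b² + 20a³b² + 9a⁴b² + 6b³ + 12ab³ + 22a²b³ + 12a³b³ + 16ab⁴ + 10a²b⁴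 + 4b⁵ + 4ab⁵ + b⁶, set t₊ = (G₁ − (b²−1)√J₁)/(2c₂) and t₋ = (G₁ + (b²−1)√J₁)/(2c₂). Then for every real t, the symmetric matrix (A + tB₀)ᵀ(A + tB₀) has a repeated eigenvalue (i.e. fewer than three distinct real eigenvalues) if and only if t = t₊ or t = t₋. -/
open Matrix

set_option maxHeartbeats 4000000

/-- A symmetric real 3×3 matrix with fewer than three eigenvalues is a rank-one perturbation of a
scalar matrix. -/
lemma exists_of_ncard_lt (S : Matrix (Fin 3) (Fin 3) ℝ) (hS : S.IsHermitian)
    (h : (spectrum ℝ S).ncard < 3) :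
    ∃ (l c : ℝ) (w : Fin 3 → ℝ), ∀ i j, S i j = (if i = j then l else 0) + c * (w i * w j) := by
  rw [hS.spectrum_real_eq_range_eigenvalues] at h
  have hni : ¬ Function.Injective hS.eigenvalues := by
    intro hinj
    rw [← Set.image_univ, Set.ncard_image_of_injective _ hinj, Set.ncard_univ] at h
    simp at h
  have key : ∃ k l m : Fin 3, (∀ f : Fin 3 → ℝ, ∑ i, f i = f k + f l + f m) ∧
      hS.eigenvalues k = hS.eigenvalues l := by
    simp only [Function.Injective, not_forall] at hni
    obtain ⟨k, l, hkl, hne⟩ := hni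
    have third : ∀ k l : Fin 3, k ≠ l → ∃ m : Fin 3, m ≠ k ∧ m ≠ l := by decide
    obtain ⟨m, hmk, hml⟩ := third k l hne
    refine ⟨k, l, m, fun f => ?_, hkl⟩
    have hu : (Finset.univ : Finset (Fin 3)) = {k, l, m} := by
      clear hkl
      revert k l m
      decide
    rw [hu, Finset.sum_insert (by simp [hne, hmk.symm]), Finset.sum_insert (by simp [hml.symm]),
      Finset.sum_singleton, add_assoc]
  obtain ⟨k, l, m, hsum, heq⟩ := key
  set U : Matrix (Fin 3) (Fin 3) ℝ := (hS.eigenvectorUnitary : Matrix (Fin 3) (Fin 3) ℝ) with hU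
  have h1 : U * star U = 1 := Unitary.coe_mul_star_self _
  have h2 : S = U * Matrix.diagonal hS.eigenvalues * star U := by
    have := hS.spectral_theorem
    simpa using this
  refine ⟨hS.eigenvalues k, hS.eigenvalues m - hS.eigenvalues k, fun i => U i m, ?_⟩
  intro i j
  have e1 := congrFun (congrFun h1 i) j
  have e2 := congrFun (congrFun h2 i) j
  rw [Matrix.mul_apply, hsum] at e1 e2
  simp only [Matrix.mul_diagonal, Matrix.star_apply, star_trivial, Matrix.one_apply] at e1 e2
  rw [e2, ← heq]
  have : (if i = j then hS.eigenvalues k else 0) = hS.eigenvalues k * (if i = j then 1 else 0) := by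
    split_ifs <;> simp
  rw [this, ← e1]
  ring

lemma ncard_lt_of_rank_one (S : Matrix (Fin 3) (Fin 3) ℝ) (l c : ℝ) (w : Fin 3 → ℝ)
    (h : ∀ i j, S i j = (if i = j then l else 0) + c * (w i * w j)) :
    (spectrum ℝ S).ncard < 3 := by
  have hsub : spectrum ℝ S ⊆ {l, l + c * (w 0 ^ 2 + w 1 ^ 2 + w 2 ^ 2)} := by
    intro x hx
    rw [spectrum.mem_iff, Matrix.isUnit_iff_isUnit_det, isUnit_iff_ne_zero, not_not,
      Matrix.det_fin_three] at hx
    simp [Matrix.algebraMap_matrix_apply, h] at hx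
    have : (x - l) ^ 2 * (x - (l + c * (w 0 ^ 2 + w 1 ^ 2 + w 2 ^ 2))) = 0 := by
      rw [← hx]; ring
    rcases mul_eq_zero.1 this with h | h
    · left; have := pow_eq_zero_iff (two_ne_zero) |>.1 h; linarith
    · right; simp; linarith
  calc _ ≤ _ := Set.ncard_le_ncard hsub (by simp)
    _ ≤ 2 := (Set.ncard_insert_le _ _).trans (by simp)
    _ < 3 := by norm_num


/-- Fully explicit version of the main result, for a symmetric matrix with nonzero off-diagonal
entries. -/
lemma ncard_lt_of_minors (S : Matrix (Fin 3) (Fin 3) ℝ) (hS : ∀ i j, S i j = S j i)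
    (h01 : S 0 1 ≠ 0) (h02 : S 0 2 ≠ 0) (h12 : S 1 2 ≠ 0)
    (F1 : (S 0 0 - S 1 1) * (S 0 2 * S 1 2) - S 0 1 * (S 0 2 ^ 2 - S 1 2 ^ 2) = 0)
    (F2 : (S 0 0 - S 2 2) * (S 0 1 * S 1 2) - S 0 2 * (S 0 1 ^ 2 - S 1 2 ^ 2) = 0) :
    (spectrum ℝ S).ncard < 3 := by
  have e10 := hS 1 0
  have e20 := hS 2 0
  have e21 := hS 2 1
  generalize hx : S 0 1 = x at *
  generalize hy : S 0 2 = y at *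
  generalize hz : S 1 2 = z at *
  refine ncard_lt_of_rank_one S (S 0 0 - x * y / z) (1 / (x * y * z))
    ![x * y, x * z, y * z] ?_
  have g1 : S 1 1 = S 0 0 - x * y / z + 1 / (x * y * z) * (x * z * (x * z)) := by
    field_simp
    linear_combination -F1
  have g2 : S 2 2 = S 0 0 - x * y / z + 1 / (x * y * z) * (y * z * (y * z)) := by
    field_simp
    linear_combination -F2
  have g0 : S 0 0 = S 0 0 - x * y / z + 1 / (x * y * z) * (x * y * (x * y)) := by
    field_simp
    ring
  have k01 : x = 1 / (x * y * z) * (x * y * (x * z)) := by field_simp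
  have k02 : y = 1 / (x * y * z) * (x * y * (y * z)) := by field_simp
  have k12 : z = 1 / (x * y * z) * (x * z * (y * z)) := by field_simp
  intro i j
  fin_cases i <;> fin_cases j
  · simpa using g0
  · simpa [hx] using k01
  · simpa [hy] using k02
  · simpa [e10, mul_comm (x * z) (x * y)] using k01
  · simpa using g1
  · simpa [hz] using k12
  · simpa [e20, mul_comm (y * z) (x * y)] using k02
  · simpa [e21, mul_comm (y * z) (x * z)] using k12
  · simpa using g2

lemma repeated_facts (a b : ℝ) (ha : 1 < a) (hab : a < b) (Q : ℝ → ℝ) (c₂ G₁ J₁ c₀ : ℝ)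
    (hc₂ : c₂ = -1 - a - 2 * a ^ 2 - 4 * b - 7 * a * b - 4 * a ^ 2 * b + 2 * b ^ 2
      - 7 * a * b ^ 2 - 2 * a ^ 2 * b ^ 2 - 4 * b ^ 3 - a * b ^ 3 - b ^ 4)
    (hG₁ : G₁ = 1 - 2 * a - a ^ 2 - 4 * a ^ 3 + 6 * b + 4 * a * b - 7 * a ^ 2 * b
      - 8 * a ^ 3 * b + b ^ 2 + 12 * a * b ^ 2 - 7 * a ^ 2 * b ^ 2 - 4 * a ^ 3 * b ^ 2
      + b ^ 3 + 4 * a * b ^ 3 - a ^ 2 * b ^ 3 + 6 * b ^ 4 - 2 * a * b ^ 4 + b ^ 5)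
    (hJ₁ : J₁ = 1 + 4 * a + 10 * a ^ 2 + 12 * a ^ 3 + 9 * a ^ 4 + 4 * b + 16 * a * b
      + 22 * a ^ 2 * b + 20 * a ^ 3 * b - 2 * a ^ 4 * b + 12 * a * b ^ 2 + 32 * a ^ 2 * b ^ 2
      + 20 * a ^ 3 * b ^ 2 + 9 * a ^ 4 * b ^ 2 + 6 * b ^ 3 + 12 * a * b ^ 3 + 22 * a ^ 2 * b ^ 3
      + 12 * a ^ 3 * b ^ 3 + 16 * a * b ^ 4 + 10 * a ^ 2 * b ^ 4 + 4 * b ^ 5 + 4 * a * b ^ 5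
      + b ^ 6)
    (hc₀ : c₀ = (-2)*a^4*b^2 + (-4)*a^4*b^1 + (-2)*a^4 + (4)*a^2*b^3 + (8)*a^2*b^2 + (4)*a^2*b^1 + (2)*a^1*b^5 + (2)*a^1*b^4 + (-4)*a^1*b^3 + (-4)*a^1*b^2 + (2)*a^1*b^1 + (2)*a^1 + (-2)*b^5 + (-2)*b^4 + (-2)*b^2 + (-2)*b^1)
    (hQ : ∀ t, Q t = c₂ * t ^ 2 - G₁ * t + c₀) :
    c₂ < 0 ∧ 0 < J₁ ∧ 0 < Q 0 ∧ 0 < Q (a - 1) ∧ Q (-1 - b) < 0 ∧ 0 < Q (a - b) ∧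
      G₁ ^ 2 - 4 * c₂ * c₀ = (b ^ 2 - 1) ^ 2 * J₁ := by
  obtain ⟨x, hx, rfl⟩ : ∃ x, 0 < x ∧ a = 1 + x := ⟨a - 1, by linarith, by ring⟩
  obtain ⟨y, hy, rfl⟩ : ∃ y, 0 < y ∧ b = 1 + x + y := ⟨b - (1 + x), by linarith, by ring⟩
  simp only [hQ]
  subst hc₂ hG₁ hJ₁ hc₀
  refine ⟨?_, ?_, ?_, ?_, ?_, ?_, by ring⟩
  · rw [← neg_pos]; ring_nf; positivity
  · ring_nf; positivity
  · ring_nf; positivity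
  · ring_nf; positivity
  · rw [← neg_pos]; ring_nf; positivity
  · ring_nf; positivity

/-- For the optimal rank-one direction `B₀`, the symmetric matrix `(A + tB₀)ᵀ(A + tB₀)` has a
repeated eigenvalue (fewer than three distinct real eigenvalues) precisely at the two parameter
values `t = t₊` and `t = t₋`. -/
theorem repeated_eigenvalue_iff (a b : ℝ) (ha : 1 < a) (hab : a < b)
    (D : ℝ) (hD : D = 1 + a + a ^ 2 + (a - 1) * b + b ^ 2)
    (u₁ u₂ u₃ : ℝ)
    (hu₁ : u₁ = (b - 1) / Real.sqrt (2 * (b + 1) * D))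
    (hu₂ : u₂ = Real.sqrt ((1 + 2 * a ^ 2 + b ^ 2 + 2 * a * (1 + b)) / (2 * D)))
    (hu₃ : u₃ = (b - 1) * Real.sqrt b / Real.sqrt (2 * (b + 1) * D))
    (A B₀ : Matrix (Fin 3) (Fin 3) ℝ)
    (hA : A = Matrix.diagonal ![1, a, b])
    (hB₀ : B₀ = Matrix.vecMulVec ![u₁, u₂, u₃] ![u₁, -u₂, u₃])
    (c₂ G₁ J₁ tP tM : ℝ)
    (hc₂ : c₂ = -1 - a - 2 * a ^ 2 - 4 * b - 7 * a * b - 4 * a ^ 2 * b + 2 * b ^ 2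
      - 7 * a * b ^ 2 - 2 * a ^ 2 * b ^ 2 - 4 * b ^ 3 - a * b ^ 3 - b ^ 4)
    (hG₁ : G₁ = 1 - 2 * a - a ^ 2 - 4 * a ^ 3 + 6 * b + 4 * a * b - 7 * a ^ 2 * b
      - 8 * a ^ 3 * b + b ^ 2 + 12 * a * b ^ 2 - 7 * a ^ 2 * b ^ 2 - 4 * a ^ 3 * b ^ 2
      + b ^ 3 + 4 * a * b ^ 3 - a ^ 2 * b ^ 3 + 6 * b ^ 4 - 2 * a * b ^ 4 + b ^ 5)
    (hJ₁ : J₁ = 1 + 4 * a + 10 * a ^ 2 + 12 * a ^ 3 + 9 * a ^ 4 + 4 * b + 16 * a * b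
      + 22 * a ^ 2 * b + 20 * a ^ 3 * b - 2 * a ^ 4 * b + 12 * a * b ^ 2 + 32 * a ^ 2 * b ^ 2
      + 20 * a ^ 3 * b ^ 2 + 9 * a ^ 4 * b ^ 2 + 6 * b ^ 3 + 12 * a * b ^ 3 + 22 * a ^ 2 * b ^ 3
      + 12 * a ^ 3 * b ^ 3 + 16 * a * b ^ 4 + 10 * a ^ 2 * b ^ 4 + 4 * b ^ 5 + 4 * a * b ^ 5
      + b ^ 6)
    (htP : tP = (G₁ - (b ^ 2 - 1) * Real.sqrt J₁) / (2 * c₂))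
    (htM : tM = (G₁ + (b ^ 2 - 1) * Real.sqrt J₁) / (2 * c₂)) :
    ∀ t : ℝ,
      (spectrum ℝ ((A + t • B₀)ᵀ * (A + t • B₀))).ncard < 3 ↔ (t = tP ∨ t = tM) := by
  
  have hb : 1 < b := ha.trans hab
  obtain ⟨c₀, hc₀⟩ : ∃ c₀ : ℝ, c₀ = (-2)*a^4*b^2 + (-4)*a^4*b^1 + (-2)*a^4 + (4)*a^2*b^3 + (8)*a^2*b^2 + (4)*a^2*b^1 + (2)*a^1*b^5 + (2)*a^1*b^4 + (-4)*a^1*b^3 + (-4)*a^1*b^2 + (2)*a^1*b^1 + (2)*a^1 + (-2)*b^5 + (-2)*b^4 + (-2)*b^2 + (-2)*b^1 := ⟨_, rfl⟩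
  obtain ⟨Q, hQ⟩ : ∃ Q : ℝ → ℝ, ∀ t, Q t = c₂ * t ^ 2 - G₁ * t + c₀ := ⟨_, fun _ => rfl⟩
  obtain ⟨hc2n, hJp, hQ0, hQ1, hQ2, hQ3, hdisc⟩ :=
    repeated_facts a b ha hab Q c₂ G₁ J₁ c₀ hc₂ hG₁ hJ₁ hc₀ hQ
  have hDp : 0 < D := by rw [hD]; nlinarith
  obtain ⟨K, hK⟩ : ∃ K : ℝ, K = 2 * (b + 1) * D := ⟨_, rfl⟩
  have hKp : 0 < K := by rw [hK]; positivity
  rw [← hK] at hu₁ hu₃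
  have hsK := Real.sq_sqrt hKp.le
  have hsK0 : 0 < Real.sqrt K := Real.sqrt_pos.2 hKp
  have hNp : 0 < 1 + 2 * a ^ 2 + b ^ 2 + 2 * a * (1 + b) := by positivity
  have p1 : 0 < u₁ := by rw [hu₁]; exact div_pos (by linarith) hsK0
  have p2 : 0 < u₂ := by rw [hu₂]; exact Real.sqrt_pos.2 (by positivity)
  have hu31 : u₃ = Real.sqrt b * u₁ := by rw [hu₃, hu₁]; ring
  have p3 : 0 < u₃ := by rw [hu31]; exact mul_pos (Real.sqrt_pos.2 (by linarith)) p1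
  have s1 : K * u₁ ^ 2 = (b - 1) ^ 2 := by
    rw [hu₁, div_pow, hsK]; field_simp
  have s2 : K * u₂ ^ 2 = (1 + 2 * a ^ 2 + b ^ 2 + 2 * a * (1 + b)) * (b + 1) := by
    rw [hu₂, Real.sq_sqrt (by positivity), hK]; field_simp
  have s3 : u₃ ^ 2 = b * u₁ ^ 2 := by
    rw [hu31, mul_pow, Real.sq_sqrt (by linarith)]
  intro t
  have hroot : Q t = 0 ↔ (t = tP ∨ t = tM) := by
    have hs := Real.sq_sqrt hJp.le
    have e : 4 * c₂ * Q t = (2 * c₂ * t - (G₁ - (b ^ 2 - 1) * Real.sqrt J₁)) *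
        (2 * c₂ * t - (G₁ + (b ^ 2 - 1) * Real.sqrt J₁)) := by
      rw [hQ]; linear_combination (b ^ 2 - 1) ^ 2 * hs - hdisc
    have h4 : 4 * c₂ ≠ 0 := by linarith
    have h2 : 2 * c₂ ≠ 0 := by linarith
    rw [htP, htM, eq_div_iff h2, eq_div_iff h2, ← mul_right_inj' h4, mul_zero, e, mul_eq_zero,
      sub_eq_zero, sub_eq_zero, mul_comm t]
  rw [← hroot]
  obtain ⟨S, hS⟩ : ∃ S, S = (A + t • B₀)ᵀ * (A + t • B₀) := ⟨_, rfl⟩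
  rw [← hS]
  have hherm : S.IsHermitian := by
    rw [hS]; exact Matrix.isHermitian_conjTranspose_mul_self (A + t • B₀)
  have hsym : ∀ i j, S i j = S j i := fun i j => by simpa using (hherm.apply i j).symm
  have n1 : (b + 1) * u₁ ^ 2 + u₂ ^ 2 = 1 := by
    have : K * ((b + 1) * u₁ ^ 2 + u₂ ^ 2) = K * 1 := by
      rw [mul_add, mul_left_comm, s1, s2, hK, hD]; ring
    exact mul_left_cancel₀ hKp.ne' this
  have S00 : S 0 0 = 1 + (2 * t + t ^ 2) * u₁ ^ 2 := by
    simp [hS, hA, hB₀, Matrix.mul_apply, Fin.sum_univ_three, Matrix.vecMulVec_apply]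
    linear_combination t ^ 2 * u₁ ^ 2 * (n1 + s3)
  have S11 : S 1 1 = a ^ 2 + (-2 * a * t + t ^ 2) * u₂ ^ 2 := by
    simp [hS, hA, hB₀, Matrix.mul_apply, Fin.sum_univ_three, Matrix.vecMulVec_apply]
    linear_combination t ^ 2 * u₂ ^ 2 * (n1 + s3)
  have S22 : S 2 2 = b ^ 2 + (2 * b * t + t ^ 2) * u₃ ^ 2 := by
    simp [hS, hA, hB₀, Matrix.mul_apply, Fin.sum_univ_three, Matrix.vecMulVec_apply]
    linear_combination t ^ 2 * u₃ ^ 2 * (n1 + s3)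
  have S01 : S 0 1 = t * (u₁ * u₂ * (a - 1 - t)) := by
    simp [hS, hA, hB₀, Matrix.mul_apply, Fin.sum_univ_three, Matrix.vecMulVec_apply]
    linear_combination -t ^ 2 * u₁ * u₂ * (n1 + s3)
  have S02 : S 0 2 = t * (u₁ * u₃ * (1 + b + t)) := by
    simp [hS, hA, hB₀, Matrix.mul_apply, Fin.sum_univ_three, Matrix.vecMulVec_apply]
    linear_combination t ^ 2 * u₁ * u₃ * (n1 + s3)
  have S12 : S 1 2 = t * (u₂ * u₃ * (a - b - t)) := by
    simp [hS, hA, hB₀, Matrix.mul_apply, Fin.sum_univ_three, Matrix.vecMulVec_apply]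
    linear_combination -t ^ 2 * u₂ * u₃ * (n1 + s3)
  clear hS
  have F1 : K * ((S 0 0 - S 1 1) * (S 0 2 * S 1 2) - S 0 1 * (S 0 2 ^ 2 - S 1 2 ^ 2)) =
      t ^ 2 * u₁ * u₂ * u₃ ^ 2 * ((a + 1) * Q t) := by
    have e : K * (1 - a ^ 2) * (1 + b + t) * (a - b - t)
        + ((2 * t + t ^ 2) * (K * u₁ ^ 2) - (-2 * a * t + t ^ 2) * (K * u₂ ^ 2))
          * (1 + b + t) * (a - b - t)
        - t * (a - 1 - t) * ((K * u₁ ^ 2) * (1 + b + t) ^ 2 - (K * u₂ ^ 2) * (a - b - t) ^ 2)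
        = (a + 1) * Q t := by
      rw [s1, s2, hQ, hK, hD, hc₂, hG₁, hc₀]; ring
    rw [← e, S00, S11, S01, S02, S12]; ring
  have F2 : K * ((S 0 0 - S 2 2) * (S 0 1 * S 1 2) - S 0 2 * (S 0 1 ^ 2 - S 1 2 ^ 2)) =
      t ^ 2 * u₁ * u₂ ^ 2 * u₃ * ((b - 1) * Q t) := by
    have e : K * (1 - b ^ 2) * (a - 1 - t) * (a - b - t)
        + ((2 * t + t ^ 2) * (K * u₁ ^ 2) - (2 * b * t + t ^ 2) * (b * (K * u₁ ^ 2)))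
          * (a - 1 - t) * (a - b - t)
        - t * (1 + b + t) * ((K * u₁ ^ 2) * (a - 1 - t) ^ 2
          - (b * (K * u₁ ^ 2)) * (a - b - t) ^ 2)
        = (b - 1) * Q t := by
      rw [s1, hQ, hK, hD, hc₂, hG₁, hc₀]; ring
    have e3 : b * (K * u₁ ^ 2) = K * u₃ ^ 2 := by rw [s3]; ring
    rw [e3] at e
    rw [← e, S00, S22, S01, S02, S12]; ring
  have nz : t ≠ 0 → t ≠ a - 1 → t ≠ -1 - b → t ≠ a - b →
      S 0 1 ≠ 0 ∧ S 0 2 ≠ 0 ∧ S 1 2 ≠ 0 := by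
    intro h0 h1 h2 h3
    rw [S01, S02, S12]
    refine ⟨mul_ne_zero h0 (mul_ne_zero (by positivity) fun h => h1 (by linarith)),
      mul_ne_zero h0 (mul_ne_zero (by positivity) fun h => h2 (by linarith)),
      mul_ne_zero h0 (mul_ne_zero (by positivity) fun h => h3 (by linarith))⟩
  constructor
  · intro h
    obtain ⟨l, c, w, hw⟩ := exists_of_ncard_lt S hherm h
    have w00 := hw 0 0
    have w11 := hw 1 1
    have w22 := hw 2 2
    have w01 := hw 0 1
    have w02 := hw 0 2
    have w12 := hw 1 2
    simp at w00 w11 w22 w01 w02 w12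
    by_cases ht : t = 0
    · exfalso
      subst ht
      rw [S00] at w00
      rw [S11] at w11
      rw [S22] at w22
      rw [S01] at w01
      rw [S02] at w02
      rw [S12] at w12
      simp at w00 w11 w22 w01 w02 w12
      have ha2 : 1 < a ^ 2 := by nlinarith
      have hb2 : a ^ 2 < b ^ 2 := by nlinarith
      rcases w01 with h | h | h
      · simp [h] at w00 w11; linarith
      · rcases w12 with h' | h' | h'
        · simp [h'] at w00 w11; linarith
        · simp [h, h'] at w00 w11; linarith
        · simp [h, h'] at w00 w22; linarith
      · rcases w02 with h' | h' | h'
        · simp [h'] at w00 w11; linarith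
        · simp [h, h'] at w00 w11; linarith
        · simp [h, h'] at w11 w22; linarith
    · have z1 : (S 0 0 - S 1 1) * (S 0 2 * S 1 2) - S 0 1 * (S 0 2 ^ 2 - S 1 2 ^ 2) = 0 := by
        rw [w00, w11, w01, w02, w12]; ring
      rw [z1, mul_zero] at F1
      have : t ^ 2 * u₁ * u₂ * u₃ ^ 2 * (a + 1) ≠ 0 := by
        have : a + 1 ≠ 0 := by linarith
        positivity
      apply (mul_eq_zero.1 (?_ : t ^ 2 * u₁ * u₂ * u₃ ^ 2 * (a + 1) * Q t = 0)).resolve_left this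
      rw [F1]; ring
  · intro h
    obtain ⟨k1, k2, k3⟩ := nz (by rintro rfl; linarith) (by rintro rfl; linarith)
      (by rintro rfl; linarith) (by rintro rfl; linarith)
    rw [h, mul_zero, mul_zero] at F1 F2
    exact ncard_lt_of_minors S hsym k1 k2 k3 ((mul_eq_zero.1 F1).resolve_left hKp.ne')
      ((mul_eq_zero.1 F2).resolve_left hKp.ne')
end
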